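/- Let s ∈ (0,1) and let f, g : ℝ^d → (0,∞) be strictly positive measurable probability densities with respect to Lebesgue measure satisfying i_s(f) < ∞ and i_s(g) < ∞. Then for every α ∈ (0,1), the fractional Fisher information satisfies the Blachman–Stam inequality i_s(f_{√α} ∗ g_{√(1−α)}) ≤ α^s·i_s(f) + (1−α)^s·i_s(g), where ∗ denotes convolution on ℝ^d and f_c(x) = c^{−d}·f(x/c) for c > 0. -/

import Mathlib

open MeasureTheory ENNReal

/-- `Upsilon r = exp r - 1 - r`. -/
noncomputable def Upsilon (r : ℝ) : ℝ := Real.exp r - 1 - r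

/-- The normalizing constant `c(d,s) = (∫_{ℝ^d} (1 − cos ξ₁)/|ξ|^{d+2s} dξ)⁻¹` of the
fractional Laplacian. -/
noncomputable def fracC (d : ℕ) [NeZero d] (s : ℝ) : ℝ :=
  (∫ ξ : EuclideanSpace ℝ (Fin d), (1 - Real.cos (ξ 0)) / ‖ξ‖ ^ ((d : ℝ) + 2 * s))⁻¹

/-- The fractional Fisher information
`i_s(f) = c(d,s) ∫∫ f(x) Υ(log f(x+h) − log f(x)) / |h|^{d+2s} dh dx ∈ [0,∞]`. -/
noncomputable def fracFisher (d : ℕ) [NeZero d] (s : ℝ)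
    (f : EuclideanSpace ℝ (Fin d) → ℝ) : ℝ≥0∞ :=
  ENNReal.ofReal (fracC d s) *
    ∫⁻ x, ∫⁻ h, ENNReal.ofReal
      (f x * Upsilon (Real.log (f (x + h)) - Real.log (f x)) / ‖h‖ ^ ((d : ℝ) + 2 * s))

lemma Upsilon_nonneg (r : ℝ) : 0 ≤ Upsilon r := by
  have := Real.add_one_le_exp r
  unfold Upsilon
  linarith

lemma measurable_Upsilon : Measurable Upsilon := by
  unfold Upsilon
  fun_prop

lemma mul_Upsilon_log_sub_log {a b : ℝ} (ha : 0 < a) (hb : 0 < b) :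
    a * Upsilon (Real.log b - Real.log a) = b - a - a * (Real.log b - Real.log a) := by
  unfold Upsilon
  rw [Real.exp_sub, Real.exp_log ha, Real.exp_log hb]
  field_simp

/-- The tangent plane at `(A, B)` lies below the convex, one-homogeneous function
`(a, b) ↦ a Υ(log b − log a)`. -/
lemma tangent_le_mul_Upsilon {a b A B : ℝ} (ha : 0 < a) (hb : 0 < b) (hA : 0 < A) (hB : 0 < B) :
    b * (1 - A / B) - a * (Real.log B - Real.log A)
      ≤ a * Upsilon (Real.log b - Real.log a) := by
  rw [mul_Upsilon_log_sub_log ha hb]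
  have hx : 0 < b * A / (a * B) := by positivity
  have h := Real.log_le_sub_one_of_pos hx
  rw [Real.log_div (by positivity) (by positivity), Real.log_mul hb.ne' hA.ne',
    Real.log_mul ha.ne' hB.ne'] at h
  have h2 := mul_le_mul_of_nonneg_left h ha.le
  have h3 : a * (b * A / (a * B) - 1) = b * (A / B) - a := by field_simp
  rw [h3] at h2
  linarith

lemma ofReal_integral_le_lintegral_ofReal {X : Type*} [MeasurableSpace X] {μ : Measure X}
    {u : X → ℝ} (hu : Integrable u μ) :
    ENNReal.ofReal (∫ x, u x ∂μ) ≤ ∫⁻ x, ENNReal.ofReal (u x) ∂μ := by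
  rw [integral_eq_lintegral_pos_part_sub_lintegral_neg_part hu]
  refine ENNReal.ofReal_le_of_le_toReal ?_
  linarith [ENNReal.toReal_nonneg (a := ∫⁻ x, ENNReal.ofReal (-u x) ∂μ)]

/-- Jensen's inequality for `(a, b) ↦ a Υ(log b − log a)`. -/
lemma mul_Upsilon_integral_le {X : Type*} [MeasurableSpace X] {μ : Measure X} {a b : X → ℝ}
    (ha : ∀ x, 0 < a x) (hb : ∀ x, 0 < b x) (hai : Integrable a μ) (hbi : Integrable b μ)
    (hA : 0 < ∫ x, a x ∂μ) (hB : 0 < ∫ x, b x ∂μ) :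
    ENNReal.ofReal ((∫ x, a x ∂μ) * Upsilon (Real.log (∫ x, b x ∂μ) - Real.log (∫ x, a x ∂μ)))
      ≤ ∫⁻ x, ENNReal.ofReal (a x * Upsilon (Real.log (b x) - Real.log (a x))) ∂μ := by
  set A := ∫ x, a x ∂μ with hAdef
  set B := ∫ x, b x ∂μ with hBdef
  have h1 : A * Upsilon (Real.log B - Real.log A)
      = ∫ x, (b x * (1 - A / B) - a x * (Real.log B - Real.log A)) ∂μ := by
    rw [integral_sub (hbi.mul_const _) (hai.mul_const _), integral_mul_const, integral_mul_const,
      ← hAdef, ← hBdef, mul_Upsilon_log_sub_log hA hB]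
    field_simp
  rw [h1]
  refine (ofReal_integral_le_lintegral_ofReal
    ((hbi.mul_const _).sub (hai.mul_const _))).trans ?_
  exact lintegral_mono fun x =>
    ENNReal.ofReal_le_ofReal (tangent_le_mul_Upsilon (ha x) (hb x) hA hB)

lemma mul_Upsilon_log_mul {a b a' b' : ℝ} (ha : 0 < a) (hb : 0 < b) (ha' : 0 < a')
    (hb' : 0 < b') :
    a * b * Upsilon (Real.log (a' * b') - Real.log (a * b)) + (a' * b + a * b')
      = b * (a * Upsilon (Real.log a' - Real.log a))
        + a * (b * Upsilon (Real.log b' - Real.log b)) + (a' * b' + a * b) := by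
  rw [mul_Upsilon_log_sub_log (by positivity) (by positivity), mul_Upsilon_log_sub_log ha ha',
    mul_Upsilon_log_sub_log hb hb', Real.log_mul ha.ne' hb.ne', Real.log_mul ha'.ne' hb'.ne']
  ring

section

variable {V : Type*} [NormedAddCommGroup V] [MeasurableSpace V]

/-- The nonlocal entropy production `∫ f(x) Υ(log f(x+h) − log f(x)) dx` of a fixed jump `h`. -/
noncomputable def jumpFisher (μ : Measure V) (f : V → ℝ) (h : V) : ℝ≥0∞ :=
  ∫⁻ x, ENNReal.ofReal (f x * Upsilon (Real.log (f (x + h)) - Real.log (f x))) ∂μ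

variable [BorelSpace V]

lemma measurable_mul_Upsilon [SecondCountableTopology V] {f : V → ℝ} (hf : Measurable f) :
    Measurable fun p : V × V =>
      ENNReal.ofReal (f p.1 * Upsilon (Real.log (f (p.1 + p.2)) - Real.log (f p.1))) := by
  have := measurable_Upsilon
  fun_prop

lemma measurable_jumpFisher [SecondCountableTopology V] (μ : Measure V) [SFinite μ]
    {f : V → ℝ} (hf : Measurable f) :
    Measurable (jumpFisher μ f) :=
  (measurable_mul_Upsilon hf).lintegral_prod_left'

variable {μ : Measure V} [SFinite μ] [μ.IsAddHaarMeasure]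

lemma lintegral_mul_Upsilon_prod_eq {F G : V → ℝ}
    (hF : Measurable F) (hG : Measurable G) (hFpos : ∀ x, 0 < F x) (hGpos : ∀ x, 0 < G x)
    (hF1 : ∫⁻ x, ENNReal.ofReal (F x) ∂μ = 1) (hG1 : ∫⁻ x, ENNReal.ofReal (G x) ∂μ = 1)
    (u v : V) :
    ∫⁻ y, ∫⁻ x, ENNReal.ofReal (F x * G y *
        Upsilon (Real.log (F (x + u) * G (y + v)) - Real.log (F x * G y))) ∂μ ∂μ
      = jumpFisher μ F u + jumpFisher μ G v := by
  have hU := measurable_Upsilon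
  have shift : ∀ (w : V → ℝ) (t : V),
      ∫⁻ x, ENNReal.ofReal (w (x + t)) ∂μ = ∫⁻ x, ENNReal.ofReal (w x) ∂μ := fun w t =>
    lintegral_add_right_eq_self (fun x => ENNReal.ofReal (w x)) t
  have prod : ∀ P Q : V → ℝ≥0∞, Measurable P → Measurable Q →
      ∫⁻ y, ∫⁻ x, P x * Q y ∂μ ∂μ = (∫⁻ x, P x ∂μ) * ∫⁻ y, Q y ∂μ := by
    intro P Q hP hQ
    simp_rw [lintegral_mul_const _ hP]
    rw [lintegral_const_mul _ hQ]
  have key : ∀ x y, ENNReal.ofReal (F x * G y *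
        Upsilon (Real.log (F (x + u) * G (y + v)) - Real.log (F x * G y)))
        + (ENNReal.ofReal (F (x + u)) * ENNReal.ofReal (G y)
          + ENNReal.ofReal (F x) * ENNReal.ofReal (G (y + v)))
      = ENNReal.ofReal (F x * Upsilon (Real.log (F (x + u)) - Real.log (F x)))
          * ENNReal.ofReal (G y)
        + ENNReal.ofReal (F x)
          * ENNReal.ofReal (G y * Upsilon (Real.log (G (y + v)) - Real.log (G y)))
        + (ENNReal.ofReal (F (x + u)) * ENNReal.ofReal (G (y + v))
          + ENNReal.ofReal (F x) * ENNReal.ofReal (G y)) := by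
    intro x y
    have h := mul_Upsilon_log_mul (hFpos x) (hGpos y) (hFpos (x + u)) (hGpos (y + v))
    have n1 := Upsilon_nonneg (Real.log (F (x + u)) - Real.log (F x))
    have n2 := Upsilon_nonneg (Real.log (G (y + v)) - Real.log (G y))
    have n3 := Upsilon_nonneg (Real.log (F (x + u) * G (y + v)) - Real.log (F x * G y))
    have p1 := (hFpos x).le
    have p2 := (hGpos y).le
    have p3 := (hFpos (x + u)).le
    have p4 := (hGpos (y + v)).le
    rw [← ENNReal.ofReal_mul p3, ← ENNReal.ofReal_mul p1, ← ENNReal.ofReal_mul (by positivity),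
      ← ENNReal.ofReal_mul p1, ← ENNReal.ofReal_mul p3, ← ENNReal.ofReal_mul p1,
      ← ENNReal.ofReal_add (by positivity) (by positivity),
      ← ENNReal.ofReal_add (by positivity) (by positivity),
      ← ENNReal.ofReal_add (by positivity) (by positivity),
      ← ENNReal.ofReal_add (by positivity) (by positivity),
      ← ENNReal.ofReal_add (by positivity) (by positivity), h]
    congr 1
    ring
  have hint := congrArg (fun K : V → V → ℝ≥0∞ => ∫⁻ y, ∫⁻ x, K x y ∂μ ∂μ)
    (funext fun x => funext (key x))
  have m2 : Measurable fun x => ENNReal.ofReal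
      (F x * Upsilon (Real.log (F (x + u)) - Real.log (F x))) := by fun_prop
  have m3 : Measurable fun x => ENNReal.ofReal
      (G x * Upsilon (Real.log (G (x + v)) - Real.log (G x))) := by fun_prop
  have m4 : Measurable fun x => ENNReal.ofReal (F x) := by fun_prop
  have m5 : Measurable fun x => ENNReal.ofReal (F (x + u)) := by fun_prop
  have m6 : Measurable fun x => ENNReal.ofReal (G x) := by fun_prop
  have m7 : Measurable fun x => ENNReal.ofReal (G (x + v)) := by fun_prop
  have add2 : ∀ P Q : V → V → ℝ≥0∞, Measurable (fun p : V × V => P p.1 p.2) →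
      ∫⁻ y, ∫⁻ x, (P y x + Q y x) ∂μ ∂μ
        = ∫⁻ y, ∫⁻ x, P y x ∂μ ∂μ + ∫⁻ y, ∫⁻ x, Q y x ∂μ ∂μ := by
    intro P Q hP
    have hP' : Measurable fun y => ∫⁻ x, P y x ∂μ := hP.lintegral_prod_right'
    rw [← lintegral_add_left hP']
    exact lintegral_congr fun y => lintegral_add_left (hP.comp measurable_prodMk_left) _
  rw [add2, add2, add2, add2, add2,
    prod _ _ m5 m6, prod _ _ m4 m7, prod _ _ m2 m6, prod _ _ m4 m3, prod _ _ m5 m7,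
    prod _ _ m4 m6, shift F u, shift G v, hF1, hG1] at hint
  · simp only [one_mul, mul_one] at hint
    exact (ENNReal.add_left_inj (by simp)).1 hint
  all_goals fun_prop

lemma jumpFisher_convolution_le [SecondCountableTopology V] {F G : V → ℝ}
    (hF : Measurable F) (hG : Measurable G) (hFpos : ∀ x, 0 < F x) (hGpos : ∀ x, 0 < G x)
    (hF1 : ∫⁻ x, ENNReal.ofReal (F x) ∂μ = 1) (hG1 : ∫⁻ x, ENNReal.ofReal (G x) ∂μ = 1)
    (u v : V) :
    jumpFisher μ (fun x => ∫ y, F (x - y) * G y ∂μ) (u + v)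
      ≤ jumpFisher μ F u + jumpFisher μ G v := by
  have hU := measurable_Upsilon
  have integrable_of : ∀ w : V → ℝ, Measurable w → (∀ x, 0 < w x) →
      ∫⁻ x, ENNReal.ofReal (w x) ∂μ = 1 → Integrable w μ := fun w hw hpos h1 =>
    ⟨hw.aestronglyMeasurable, by
      rw [hasFiniteIntegral_iff_ofReal (Filter.Eventually.of_forall fun x => (hpos x).le), h1]
      exact ENNReal.one_lt_top⟩
  have hFi := integrable_of F hF hFpos hF1
  have hGi := integrable_of G hG hGpos hG1
  have hae : ∀ᵐ z ∂μ, Integrable (fun y => F (z - y) * G y) μ := by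
    filter_upwards [hGi.ae_convolution_exists (ContinuousLinearMap.mul ℝ ℝ) hFi] with z hz
    simpa [ConvolutionExistsAt, mul_comm] using hz
  have hae' : ∀ᵐ z ∂μ, Integrable (fun y => F (z + (u + v) - y) * G y) μ :=
    (measurePreserving_add_right μ (u + v)).quasiMeasurePreserving.ae hae
  have hpos : ∀ a : V → ℝ, (∀ y, 0 < a y) → Integrable a μ → 0 < ∫ y, a y ∂μ := by
    intro a ha hai
    rw [integral_pos_iff_support_of_nonneg (fun y => (ha y).le) hai,
      Set.eq_univ_of_forall (s := Function.support a) fun y => (ha y).ne']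
    exact Measure.measure_univ_pos.2 (NeZero.ne μ)
  calc jumpFisher μ (fun x => ∫ y, F (x - y) * G y ∂μ) (u + v)
      ≤ ∫⁻ z, ∫⁻ y, ENNReal.ofReal (F (z - y) * G y *
        Upsilon (Real.log (F (z - y + u) * G (y + v)) - Real.log (F (z - y) * G y))) ∂μ ∂μ := by
        refine lintegral_mono_ae ?_
        filter_upwards [hae, hae'] with z h1 h2
        have e : ∀ y, z + (u + v) - (y + v) = z - y + u := fun y => by abel
        have h2' : Integrable (fun y => F (z - y + u) * G (y + v)) μ := by
          have := h2.comp_add_right v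
          simpa only [e] using this
        have h3 : ∫ y, F (z + (u + v) - y) * G y ∂μ = ∫ y, F (z - y + u) * G (y + v) ∂μ := by
          rw [← integral_add_right_eq_self (fun y => F (z + (u + v) - y) * G y) v]
          simp only [e]
        have p1 : ∀ y, 0 < F (z - y) * G y := fun y => mul_pos (hFpos _) (hGpos _)
        have p2 : ∀ y, 0 < F (z - y + u) * G (y + v) := fun y => mul_pos (hFpos _) (hGpos _)
        rw [h3]
        exact mul_Upsilon_integral_le p1 p2 h1 h2' (hpos _ p1 h1) (hpos _ p2 h2')
    _ = ∫⁻ y, ∫⁻ z, ENNReal.ofReal (F (z - y) * G y *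
        Upsilon (Real.log (F (z - y + u) * G (y + v)) - Real.log (F (z - y) * G y))) ∂μ ∂μ := by
        refine lintegral_lintegral_swap (Measurable.aemeasurable ?_)
        unfold Function.uncurry
        fun_prop
    _ = ∫⁻ y, ∫⁻ x, ENNReal.ofReal (F x * G y *
        Upsilon (Real.log (F (x + u) * G (y + v)) - Real.log (F x * G y))) ∂μ ∂μ := by
        refine lintegral_congr fun y => ?_
        exact lintegral_sub_right_eq_self (fun x => ENNReal.ofReal (F x * G y *
          Upsilon (Real.log (F (x + u) * G (y + v)) - Real.log (F x * G y)))) y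
    _ = _ := lintegral_mul_Upsilon_prod_eq hF hG hFpos hGpos hF1 hG1 u v

end

section

variable {d : ℕ}

lemma lintegral_comp_inv_smul {c : ℝ} (hc : 0 < c) {w : EuclideanSpace ℝ (Fin d) → ℝ≥0∞}
    (hw : Measurable w) :
    ∫⁻ x, w (c⁻¹ • x) = ENNReal.ofReal (c ^ (d : ℝ)) * ∫⁻ x, w x := by
  have h := Measure.map_addHaar_smul (volume : Measure (EuclideanSpace ℝ (Fin d)))
    (inv_ne_zero hc.ne')
  rw [← lintegral_map hw (measurable_const_smul c⁻¹), h, lintegral_smul_measure, smul_eq_mul,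
    finrank_euclideanSpace_fin, inv_pow, inv_inv, abs_of_pos (by positivity), Real.rpow_natCast]

lemma lintegral_ofReal_dilation {c : ℝ} (hc : 0 < c) {f : EuclideanSpace ℝ (Fin d) → ℝ}
    (hf : Measurable f) :
    ∫⁻ x, ENNReal.ofReal (c ^ (-(d : ℝ)) * f (c⁻¹ • x)) = ∫⁻ x, ENNReal.ofReal (f x) := by
  have hp : 0 ≤ c ^ (-(d : ℝ)) := by positivity
  simp_rw [ENNReal.ofReal_mul hp]
  rw [lintegral_const_mul _ (by fun_prop),
    lintegral_comp_inv_smul hc (w := fun x => ENNReal.ofReal (f x)) (by fun_prop),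
    ← mul_assoc, ← ENNReal.ofReal_mul hp, ← Real.rpow_add hc]
  simp

lemma jumpFisher_dilation {c : ℝ} (hc : 0 < c) {f : EuclideanSpace ℝ (Fin d) → ℝ}
    (hf : Measurable f) (hpos : ∀ x, 0 < f x) (h : EuclideanSpace ℝ (Fin d)) :
    jumpFisher volume (fun x => c ^ (-(d : ℝ)) * f (c⁻¹ • x)) h
      = jumpFisher volume f (c⁻¹ • h) := by
  have hU := measurable_Upsilon
  unfold jumpFisher
  rw [← lintegral_ofReal_dilation hc (f := fun x =>
    f x * Upsilon (Real.log (f (x + c⁻¹ • h)) - Real.log (f x))) (by fun_prop)]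
  refine lintegral_congr fun x => ?_
  have hcd : c ^ (-(d : ℝ)) ≠ 0 := by positivity
  rw [Real.log_mul hcd (hpos _).ne', Real.log_mul hcd (hpos _).ne', add_sub_add_left_eq_sub,
    smul_add, mul_assoc]

lemma fracFisher_eq_lintegral_jumpFisher [NeZero d] (s : ℝ) {f : EuclideanSpace ℝ (Fin d) → ℝ}
    (hf : Measurable f) :
    fracFisher d s f = ENNReal.ofReal (fracC d s) *
      ∫⁻ h, jumpFisher volume f h * ENNReal.ofReal (‖h‖ ^ ((d : ℝ) + 2 * s))⁻¹ := by
  unfold fracFisher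
  have hm := measurable_mul_Upsilon hf
  have e : ∀ x h : EuclideanSpace ℝ (Fin d), ENNReal.ofReal
      (f x * Upsilon (Real.log (f (x + h)) - Real.log (f x)) / ‖h‖ ^ ((d : ℝ) + 2 * s))
      = ENNReal.ofReal (f x * Upsilon (Real.log (f (x + h)) - Real.log (f x)))
        * ENNReal.ofReal (‖h‖ ^ ((d : ℝ) + 2 * s))⁻¹ := fun x h => by
    rw [div_eq_mul_inv, ENNReal.ofReal_mul' (by positivity)]
  simp_rw [e]
  rw [lintegral_lintegral_swap]
  · congr 1
    refine lintegral_congr fun h => ?_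
    exact lintegral_mul_const _ (hm.comp measurable_prodMk_right)
  · refine Measurable.aemeasurable (Measurable.mul hm ?_)
    fun_prop

lemma lintegral_jumpFisher_smul {c : ℝ} (hc : 0 < c) (s : ℝ)
    {f : EuclideanSpace ℝ (Fin d) → ℝ} (hf : Measurable f) :
    ∫⁻ h, jumpFisher volume f (c • h) * ENNReal.ofReal (‖h‖ ^ ((d : ℝ) + 2 * s))⁻¹
      = ENNReal.ofReal (c ^ (2 * s)) *
        ∫⁻ h, jumpFisher volume f h * ENNReal.ofReal (‖h‖ ^ ((d : ℝ) + 2 * s))⁻¹ := by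
  have hm := measurable_jumpFisher volume hf
  have hmw : Measurable fun h : EuclideanSpace ℝ (Fin d) =>
      jumpFisher volume f h * ENNReal.ofReal (‖h‖ ^ ((d : ℝ) + 2 * s))⁻¹ := by fun_prop
  have hp : 0 ≤ c ^ ((d : ℝ) + 2 * s) := by positivity
  have e : ∀ h : EuclideanSpace ℝ (Fin d),
      jumpFisher volume f (c • h) * ENNReal.ofReal (‖h‖ ^ ((d : ℝ) + 2 * s))⁻¹
      = ENNReal.ofReal (c ^ ((d : ℝ) + 2 * s)) * (jumpFisher volume f (c • h) *
        ENNReal.ofReal (‖c • h‖ ^ ((d : ℝ) + 2 * s))⁻¹) := fun h => by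
    rw [mul_left_comm, ← ENNReal.ofReal_mul hp, norm_smul, Real.norm_of_nonneg hc.le,
      Real.mul_rpow hc.le (norm_nonneg h), mul_inv, mul_inv_cancel_left₀ (by positivity)]
  have hs := lintegral_comp_inv_smul (inv_pos.2 hc) hmw
  rw [inv_inv] at hs
  simp_rw [e]
  rw [lintegral_const_mul _ (by fun_prop), hs, ← mul_assoc, ← ENNReal.ofReal_mul hp,
    Real.inv_rpow hc.le, Real.rpow_add hc, mul_right_comm, mul_inv_cancel₀ (by positivity),
    one_mul]

end

/-- Blachman–Stam inequality for the fractional Fisher information: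
for probability densities `f, g` with `i_s(f), i_s(g) < ∞` and every `α ∈ (0,1)`,
`i_s(f_{√α} ∗ g_{√(1−α)}) ≤ α^s i_s(f) + (1−α)^s i_s(g)`, where
`f_c(x) = c^{−d} f(x/c)`. -/
theorem fracFisher_blachman_stam
    {d : ℕ} [NeZero d] (s : ℝ) (hs : s ∈ Set.Ioo (0 : ℝ) 1)
    (f g : EuclideanSpace ℝ (Fin d) → ℝ)
    (hfm : Measurable f) (hgm : Measurable g)
    (hfpos : ∀ x, 0 < f x) (hgpos : ∀ x, 0 < g x)
    (hf1 : ∫⁻ x, ENNReal.ofReal (f x) = 1) (hg1 : ∫⁻ x, ENNReal.ofReal (g x) = 1)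
    (hif : fracFisher d s f < ⊤) (hig : fracFisher d s g < ⊤) :
    ∀ α ∈ Set.Ioo (0 : ℝ) 1,
      fracFisher d s (fun x => ∫ y,
          (Real.sqrt α ^ (-(d : ℝ)) * f ((Real.sqrt α)⁻¹ • (x - y)))
            * (Real.sqrt (1 - α) ^ (-(d : ℝ)) * g ((Real.sqrt (1 - α))⁻¹ • y)))
        ≤ ENNReal.ofReal (α ^ s) * fracFisher d s f
          + ENNReal.ofReal ((1 - α) ^ s) * fracFisher d s g := by
  rintro α ⟨hα0, hα1⟩
  have hβ0 : 0 < 1 - α := sub_pos.2 hα1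
  have ha : 0 < √α := Real.sqrt_pos.2 hα0
  have hb : 0 < √(1 - α) := Real.sqrt_pos.2 hβ0
  set a := √α with ha_def
  set b := √(1 - α) with hb_def
  have haa : a * a = α := Real.mul_self_sqrt hα0.le
  have hbb : b * b = 1 - α := Real.mul_self_sqrt hβ0.le
  have has : a ^ (2 * s) = α ^ s := by
    rw [Real.rpow_mul ha.le, Real.rpow_two, sq, haa]
  have hbs : b ^ (2 * s) = (1 - α) ^ s := by
    rw [Real.rpow_mul hb.le, Real.rpow_two, sq, hbb]
  have hFm : Measurable fun x => a ^ (-(d : ℝ)) * f (a⁻¹ • x) := by fun_prop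
  have hGm : Measurable fun x => b ^ (-(d : ℝ)) * g (b⁻¹ • x) := by fun_prop
  have hkm : Measurable fun x => ∫ y,
      (a ^ (-(d : ℝ)) * f (a⁻¹ • (x - y))) * (b ^ (-(d : ℝ)) * g (b⁻¹ • y)) := by
    refine (StronglyMeasurable.integral_prod_right' (f := fun p : _ × _ =>
      (a ^ (-(d : ℝ)) * f (a⁻¹ • (p.1 - p.2))) * (b ^ (-(d : ℝ)) * g (b⁻¹ • p.2)))
      (Measurable.stronglyMeasurable ?_)).measurable
    fun_prop
  have hjump : ∀ h, jumpFisher volume (fun x => ∫ y,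
      (a ^ (-(d : ℝ)) * f (a⁻¹ • (x - y))) * (b ^ (-(d : ℝ)) * g (b⁻¹ • y))) h
      ≤ jumpFisher volume f (a • h) + jumpFisher volume g (b • h) := by
    intro h
    have key := jumpFisher_convolution_le (μ := volume) hFm hGm
      (fun x => mul_pos (Real.rpow_pos_of_pos ha _) (hfpos _))
      (fun x => mul_pos (Real.rpow_pos_of_pos hb _) (hgpos _))
      ((lintegral_ofReal_dilation ha hfm).trans hf1)
      ((lintegral_ofReal_dilation hb hgm).trans hg1) (α • h) ((1 - α) • h)
    rw [jumpFisher_dilation ha hfm hfpos, jumpFisher_dilation hb hgm hgpos, ← add_smul,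
      add_sub_cancel, one_smul, smul_smul, smul_smul, ← haa, inv_mul_cancel_left₀ ha.ne', haa,
      ← hbb, inv_mul_cancel_left₀ hb.ne'] at key
    exact key
  have hmf := measurable_jumpFisher volume hfm
  rw [fracFisher_eq_lintegral_jumpFisher s hkm, fracFisher_eq_lintegral_jumpFisher s hfm,
    fracFisher_eq_lintegral_jumpFisher s hgm, mul_left_comm (ENNReal.ofReal (α ^ s)),
    mul_left_comm (ENNReal.ofReal ((1 - α) ^ s)), ← mul_add, ← has, ← hbs, ← lintegral_jumpFisher_smul ha s hfm,
    ← lintegral_jumpFisher_smul hb s hgm, ← lintegral_add_left (by fun_prop)]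
  gcongr with h
  rw [← add_mul]
  gcongr
  exact hjump h
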